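/- Fix n ≥ 3, an integer r with 1 ≤ r < ⌊n/2⌋, and ℓ ∈ [n]. The set of minimal circuits in G_{n,2} that use only r-stable vertices and contain the vertex ε_{{ℓ, ℓ+r}} is in bijection with the set of compositions λ = (λ₁, …, λ_{n−r−1}) of r into n−r−1 nonnegative parts satisfying i + 1 + 2r − n ≤ Σ_{j=1}^{i} λⱼ ≤ i for all i = 1, …, n−r−1. -/

import Mathlib

/-- The characteristic vector (as a Boolean function on `ZMod n`) of the pair `{a, b}`. -/
def chiPair (n : ℕ) (a b : ZMod n) : ZMod n → Bool :=
  fun i => decide (i = a ∨ i = b)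

/-- A directed edge of `G_{n,2}`: a `1` in position `i` with a `0` in position `i+1`
moves one step to the right. -/
def EdgeStep (n : ℕ) (ε ε' : ZMod n → Bool) : Prop :=
  ∃ i : ZMod n, ε i = true ∧ ε (i + 1) = false ∧
    ε' = Function.update (Function.update ε i false) (i + 1) true

/-- A vertex of `G_{n,2}` is `r`-stable if its two `1`s have circular distance at
least `r` (circular distance of `a, b ∈ ZMod n` is `min (a-b).val (b-a).val`). -/
def RStableVert (n r : ℕ) (ε : ZMod n → Bool) : Prop :=
  ∀ a b : ZMod n, ε a = true → ε b = true → a ≠ b →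
    r ≤ min (a - b).val (b - a).val

/-- Minimal circuits in `G_{n,2}` through the vertex `ε_{{ℓ,ℓ+r}}` all of whose
vertices are `r`-stable: closed walks of length `n` based at `ε_{{ℓ,ℓ+r}}`. -/
def StableCircuit (n r : ℕ) (ℓ : ZMod n) : Type :=
  { c : Fin (n + 1) → (ZMod n → Bool) //
      c 0 = chiPair n ℓ (ℓ + r) ∧
      c (Fin.last n) = c 0 ∧
      (∀ i : Fin n, EdgeStep n (c i.castSucc) (c i.succ)) ∧
      (∀ i, RStableVert n r (c i)) }

/-- Compositions `λ = (λ₁, …, λ_{n-r-1})` of `r` into `n-r-1` nonnegative parts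
with `i + 1 + 2r - n ≤ λ₁ + ⋯ + λᵢ ≤ i` for all `i = 1, …, n-r-1`. -/
def StableComposition (n r : ℕ) : Type :=
  { l : Fin (n - r - 1) → ℕ //
      (∑ j, l j) = r ∧
      ∀ i : Fin (n - r - 1),
        ((i : ℤ) + 1) + 1 + 2 * r - n ≤ ∑ j ∈ Finset.univ.filter (· ≤ i), (l j : ℤ) ∧
        (∑ j ∈ Finset.univ.filter (· ≤ i), (l j : ℤ)) ≤ (i : ℤ) + 1 }

theorem chiPair_eq_true {n : ℕ} {a b i : ZMod n} :
    chiPair n a b i = true ↔ i = a ∨ i = b := by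
  simp [chiPair]

theorem chiPair_comm (n : ℕ) (a b : ZMod n) : chiPair n a b = chiPair n b a := by
  funext i
  simp [chiPair, or_comm]

theorem update_chiPair_left {n : ℕ} {a b : ZMod n} (hab : a ≠ b) :
    Function.update (Function.update (chiPair n a b) a false) (a + 1) true =
      chiPair n (a + 1) b := by
  funext i
  simp only [Function.update_apply, chiPair]
  split_ifs with h1 h2
  · simp [h1]
  · subst h2
    simp [h1, hab]
  · simp [h1, h2]

theorem edgeStep_chiPair_left {n : ℕ} {a b : ZMod n} (hn : (1 : ZMod n) ≠ 0) (hab : a ≠ b)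
    (h : a + 1 ≠ b) : EdgeStep n (chiPair n a b) (chiPair n (a + 1) b) :=
  ⟨a, by simp [chiPair], by simp [chiPair, h, hn], (update_chiPair_left hab).symm⟩

theorem edgeStep_chiPair_right {n : ℕ} {a b : ZMod n} (hn : (1 : ZMod n) ≠ 0) (hab : a ≠ b)
    (h : b + 1 ≠ a) : EdgeStep n (chiPair n a b) (chiPair n a (b + 1)) := by
  rw [chiPair_comm n a b, chiPair_comm n a (b + 1)]
  exact edgeStep_chiPair_left hn hab.symm h

theorem EdgeStep.of_chiPair {n : ℕ} {a b : ZMod n} {ε : ZMod n → Bool} (hab : a ≠ b)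
    (h : EdgeStep n (chiPair n a b) ε) :
    (a + 1 ≠ b ∧ ε = chiPair n (a + 1) b) ∨ (b + 1 ≠ a ∧ ε = chiPair n a (b + 1)) := by
  obtain ⟨i, hi, hi', rfl⟩ := h
  have hne : ¬ (i + 1 = a ∨ i + 1 = b) := by
    rw [← chiPair_eq_true, hi']
    simp
  rcases chiPair_eq_true.1 hi with rfl | rfl
  · exact .inl ⟨fun h => hne (.inr h), update_chiPair_left hab⟩
  · refine .inr ⟨fun h => hne (.inl h), ?_⟩
    rw [chiPair_comm n a i, chiPair_comm n a (i + 1)]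
    exact update_chiPair_left hab.symm

theorem ZMod.natCast_ne_zero_of_lt {n d : ℕ} (h0 : 0 < d) (hd : d < n) : (d : ZMod n) ≠ 0 := by
  rw [Ne, ZMod.natCast_eq_zero_iff]
  exact Nat.not_dvd_of_pos_of_lt h0 hd

theorem rStableVert_chiPair_add {n r d : ℕ} (a : ZMod n) (h0 : 0 < d) (hd : d < n) :
    RStableVert n r (chiPair n a (a + d)) ↔ r ≤ d ∧ r + d ≤ n := by
  have : NeZero n := ⟨by omega⟩
  have hd0 : (d : ZMod n) ≠ 0 := ZMod.natCast_ne_zero_of_lt h0 hd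
  have hval : (d : ZMod n).val = d := ZMod.val_cast_of_lt hd
  have hneg : (-(d : ZMod n)).val = n - d := by
    have : NeZero (d : ZMod n) := ⟨hd0⟩
    rw [ZMod.val_neg_of_ne_zero, hval]
  constructor
  · intro h
    have := h (a + d) a (chiPair_eq_true.2 (.inr rfl)) (chiPair_eq_true.2 (.inl rfl)) (by simpa)
    simp only [add_sub_cancel_left, sub_add_cancel_left, hval, hneg] at this
    omega
  · intro h x y hx hy hxy
    rcases chiPair_eq_true.1 hx with rfl | rfl <;> rcases chiPair_eq_true.1 hy with rfl | rfl
    · exact absurd rfl hxy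
    · simp only [add_sub_cancel_left, sub_add_cancel_left, hval, hneg]
      omega
    · simp only [add_sub_cancel_left, sub_add_cancel_left, hval, hneg]
      omega
    · exact absurd rfl hxy

/-- The vertex reached from `ε_{{ℓ,ℓ+r}}` after `k` moves, `m` of which are made by the
right `1`. -/
def walkVertex (n r : ℕ) (ℓ : ZMod n) (m k : ℕ) : ZMod n → Bool :=
  chiPair n (ℓ + k - m) (ℓ + r + m)

/-- The clockwise distance from the left `1` to the right `1` stays within `[r, n - r]`. -/
def IsBalanced (n r m k : ℕ) : Prop :=
  k ≤ 2 * m ∧ 2 * m + 2 * r ≤ k + n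

theorem walkVertex_eq {n r m k : ℕ} (ℓ : ZMod n) (h : k ≤ r + 2 * m) :
    walkVertex n r ℓ m k =
      chiPair n (ℓ + k - m) (ℓ + k - m + ((r + 2 * m - k : ℕ) : ZMod n)) := by
  rw [walkVertex]
  congr 1
  push_cast [h]
  ring

theorem rStableVert_walkVertex {n r m k : ℕ} (ℓ : ZMod n) (h0 : k < r + 2 * m)
    (hd : r + 2 * m < n + k) : RStableVert n r (walkVertex n r ℓ m k) ↔ IsBalanced n r m k := by
  rw [walkVertex_eq ℓ h0.le, rStableVert_chiPair_add _ (by omega) (by omega), IsBalanced]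
  omega

theorem IsBalanced.left_ne_right {n r m k : ℕ} (ℓ : ZMod n) (hr : 1 ≤ r)
    (h : IsBalanced n r m k) : ℓ + k - m ≠ ℓ + r + m := by
  obtain ⟨h1, h2⟩ := h
  have := ZMod.natCast_ne_zero_of_lt (n := n) (d := r + 2 * m - k) (by omega) (by omega)
  contrapose! this
  push_cast [show k ≤ r + 2 * m by omega]
  linear_combination -this

theorem walkVertex_left_move {n r : ℕ} (ℓ : ZMod n) (m k : ℕ) :
    walkVertex n r ℓ m (k + 1) = chiPair n (ℓ + k - m + 1) (ℓ + r + m) := by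
  rw [walkVertex]
  congr 1
  push_cast
  ring

theorem walkVertex_right_move {n r : ℕ} (ℓ : ZMod n) (m k : ℕ) :
    walkVertex n r ℓ (m + 1) (k + 1) = chiPair n (ℓ + k - m) (ℓ + r + m + 1) := by
  rw [walkVertex]
  congr 1 <;> push_cast <;> ring

theorem edgeStep_walkVertex_left {n r m k : ℕ} (ℓ : ZMod n) (hn : 2 ≤ n) (hr : 1 ≤ r)
    (h : IsBalanced n r m k) (h' : IsBalanced n r m (k + 1)) :
    EdgeStep n (walkVertex n r ℓ m k) (walkVertex n r ℓ m (k + 1)) := by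
  have : Fact (1 < n) := ⟨by omega⟩
  rw [walkVertex_left_move]
  refine edgeStep_chiPair_left one_ne_zero (h.left_ne_right ℓ hr) ?_
  have := h'.left_ne_right ℓ hr
  push_cast at this
  rwa [← add_assoc, add_sub_right_comm] at this

theorem edgeStep_walkVertex_right {n r m k : ℕ} (ℓ : ZMod n) (hn : 2 ≤ n) (hr : 1 ≤ r)
    (h : IsBalanced n r m k) (h' : IsBalanced n r (m + 1) (k + 1)) :
    EdgeStep n (walkVertex n r ℓ m k) (walkVertex n r ℓ (m + 1) (k + 1)) := by
  have : Fact (1 < n) := ⟨by omega⟩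
  rw [walkVertex_right_move]
  refine edgeStep_chiPair_right one_ne_zero (h.left_ne_right ℓ hr) ?_
  have := h'.left_ne_right ℓ hr
  push_cast at this
  contrapose! this
  linear_combination -this

theorem IsBalanced.of_edgeStep {n r m k : ℕ} {ℓ : ZMod n} {ε : ZMod n → Bool} (hr : 1 ≤ r)
    (h : IsBalanced n r m k) (hstep : EdgeStep n (walkVertex n r ℓ m k) ε)
    (hε : RStableVert n r ε) :
    (IsBalanced n r m (k + 1) ∧ ε = walkVertex n r ℓ m (k + 1)) ∨
      (IsBalanced n r (m + 1) (k + 1) ∧ ε = walkVertex n r ℓ (m + 1) (k + 1)) := by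
  obtain ⟨h1, h2⟩ := id h
  rcases hstep.of_chiPair (h.left_ne_right ℓ hr) with ⟨hne, rfl⟩ | ⟨hne, rfl⟩
  · rw [← walkVertex_left_move] at hε ⊢
    refine .inl ⟨(rStableVert_walkVertex ℓ ?_ (by omega)).1 hε, rfl⟩
    refine lt_of_le_of_ne (by omega) fun hk => hne ?_
    have := congrArg (Nat.cast : ℕ → ZMod n) hk
    push_cast at this
    linear_combination this
  · rw [← walkVertex_right_move] at hε ⊢
    refine .inr ⟨(rStableVert_walkVertex ℓ (by omega) ?_).1 hε, rfl⟩
    refine lt_of_le_of_ne (by omega) fun hk => hne ?_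
    have := congrArg (Nat.cast : ℕ → ZMod n) hk
    push_cast at this
    rw [ZMod.natCast_self] at this
    linear_combination this

theorem walkVertex_left_ne_right_move {n r m k : ℕ} (ℓ : ZMod n) (hn : 2 ≤ n) (hr : 1 ≤ r)
    (h : IsBalanced n r m k) :
    walkVertex n r ℓ m (k + 1) ≠ walkVertex n r ℓ (m + 1) (k + 1) := by
  have : Fact (1 < n) := ⟨by omega⟩
  rw [walkVertex_left_move, walkVertex_right_move]
  intro heq
  have hmem := chiPair_eq_true.2 (Or.inl rfl : ℓ + k - m = ℓ + k - m ∨ _ = ℓ + r + m + 1)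
  rw [← heq, chiPair_eq_true] at hmem
  rcases hmem with hmem | hmem
  · simp at hmem
  · exact h.left_ne_right ℓ hr hmem

/-- The sets `s` of times at which the right `1` moves in an `r`-stable minimal circuit. -/
def StableWord (n r : ℕ) : Type :=
  { s : Finset ℕ // s ⊆ Finset.range n ∧ Nat.count (· ∈ s) n = n - r ∧
      ∀ k ≤ n, IsBalanced n r (Nat.count (· ∈ s) k) k }

/-- The circuit in which the right `1` moves at the times in the given word. -/
def StableWord.toCircuit {n r : ℕ} (ℓ : ZMod n) (hn : 2 ≤ n) (hr : 1 ≤ r) (hrn : r ≤ n)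
    (s : StableWord n r) : StableCircuit n r ℓ :=
  ⟨fun k => walkVertex n r ℓ (Nat.count (· ∈ s.1) k) k, by
    obtain ⟨s, -, hcount, hbal⟩ := s
    refine ⟨by simp [walkVertex], ?_, ?_, ?_⟩
    · simp only [Fin.val_last, hcount, Fin.val_zero, Nat.count_zero, walkVertex]
      rw [chiPair_comm]
      congr 1 <;> push_cast [hrn] <;> simp
    · intro i
      have h := hbal i i.2.le
      have h' := hbal (i + 1) i.2
      simp only [Fin.val_castSucc, Fin.val_succ]
      rw [Nat.count_succ] at h' ⊢
      split_ifs at h' ⊢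
      · exact edgeStep_walkVertex_right ℓ hn hr h h'
      · exact edgeStep_walkVertex_left ℓ hn hr h h'
    · intro i
      have h := hbal i (by omega)
      obtain ⟨h1, h2⟩ := id h
      change RStableVert n r (walkVertex n r ℓ (Nat.count (· ∈ s) i) i)
      exact (rStableVert_walkVertex ℓ (by omega) (by omega)).2 h⟩

theorem StableWord.toCircuit_injective {n r : ℕ} (ℓ : ZMod n) (hn : 2 ≤ n) (hr : 1 ≤ r)
    (hrn : r ≤ n) : Function.Injective (StableWord.toCircuit ℓ hn hr hrn) := by
  rintro ⟨s, hs, hsc, hsb⟩ ⟨t, ht, htc, htb⟩ hst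
  have hvert (k : ℕ) (hk : k ≤ n) : walkVertex n r ℓ (Nat.count (· ∈ s) k) k =
      walkVertex n r ℓ (Nat.count (· ∈ t) k) k :=
    congrFun (congrArg Subtype.val hst) ⟨k, by omega⟩
  have hmem (k : ℕ) (hk : k < n) (hc : Nat.count (· ∈ s) k = Nat.count (· ∈ t) k) :
      k ∈ s ↔ k ∈ t := by
    have hv := hvert (k + 1) hk
    have hne := walkVertex_left_ne_right_move ℓ hn hr (hsb k hk.le)
    rw [Nat.count_succ, Nat.count_succ, ← hc] at hv
    split_ifs at hv with h1 h2 h2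
    · exact iff_of_true h1 h2
    · exact absurd hv.symm hne
    · exact absurd hv hne
    · exact iff_of_false h1 h2
  have hcount (k : ℕ) (hk : k ≤ n) : Nat.count (· ∈ s) k = Nat.count (· ∈ t) k := by
    induction k with
    | zero => simp
    | succ k ih =>
      rw [Nat.count_succ, Nat.count_succ, ih (by omega)]
      simp only [hmem k hk (ih (by omega))]
  refine Subtype.ext (Finset.ext fun k => ?_)
  by_cases hk : k < n
  · exact hmem k hk (hcount k hk.le)
  · exact iff_of_false (fun h => hk (Finset.mem_range.1 (hs h)))
      (fun h => hk (Finset.mem_range.1 (ht h)))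

theorem StableWord.toCircuit_surjective {n r : ℕ} (ℓ : ZMod n) (hn : 2 ≤ n) (hr : 1 ≤ r)
    (hrn : 2 * r ≤ n) :
    Function.Surjective (StableWord.toCircuit ℓ hn hr (by omega)) := by
  rintro ⟨c, hc0, hcn, hstep, hstab⟩
  have key (k : ℕ) (hk : k ≤ n) : ∃ s ⊆ Finset.range k, ∀ j (hj : j ≤ k),
      IsBalanced n r (Nat.count (· ∈ s) j) j ∧
        c ⟨j, by omega⟩ = walkVertex n r ℓ (Nat.count (· ∈ s) j) j := by
    induction k with
    | zero =>
      refine ⟨∅, by simp, fun j hj => ?_⟩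
      obtain rfl : j = 0 := by omega
      refine ⟨⟨by simp, by simpa⟩, ?_⟩
      simpa [walkVertex] using hc0
    | succ k ih =>
      obtain ⟨s, hs, hsc⟩ := ih (by omega)
      have hks : k ∉ s := fun h => by simpa using hs h
      have hstepk := hstep ⟨k, hk⟩
      rw [Fin.castSucc_mk, (hsc k le_rfl).2, Fin.succ_mk] at hstepk
      rcases (hsc k le_rfl).1.of_edgeStep hr hstepk (hstab _) with h | h
      · refine ⟨s, hs.trans (Finset.range_mono (by omega)), fun j hj => ?_⟩
        rcases Nat.le_succ_iff.1 hj with hj | rfl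
        · exact hsc j hj
        · simpa [Nat.count_succ, hks] using h
      · have hcount (j : ℕ) (hj : j ≤ k) :
            Nat.count (· ∈ insert k s) j = Nat.count (· ∈ s) j := by
          simp only [Nat.count_eq_card_filter_range]
          congr 1
          refine Finset.filter_congr fun i hi => ?_
          have := Finset.mem_range.1 hi
          simp [show i ≠ k by omega]
        refine ⟨insert k s, ?_, fun j hj => ?_⟩
        · rw [Finset.range_add_one]
          exact Finset.insert_subset_insert k hs
        rcases Nat.le_succ_iff.1 hj with hj | rfl
        · rw [hcount j hj]
          exact hsc j hj
        · have hc : Nat.count (· ∈ insert k s) (k + 1) = Nat.count (· ∈ s) k + 1 := by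
            rw [Nat.count_succ, hcount k le_rfl, if_pos (Finset.mem_insert_self k s)]
          simpa only [Nat.succ_eq_add_one, hc] using h
  obtain ⟨s, hs, hsc⟩ := key n le_rfl
  have hcount : Nat.count (· ∈ s) n = n - r := by
    obtain ⟨⟨h1, h2⟩, hlast⟩ := hsc n le_rfl
    set m := Nat.count (· ∈ s) n
    have hmem : chiPair n ℓ (ℓ + r) ℓ = true := chiPair_eq_true.2 (.inl rfl)
    rw [← hc0, ← hcn, Fin.last, hlast, walkVertex, chiPair_eq_true, ZMod.natCast_self] at hmem
    rcases hmem with hmem | hmem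
    · exact absurd (by linear_combination hmem)
        (ZMod.natCast_ne_zero_of_lt (n := n) (d := m) (by omega) (by omega))
    · have hmr : ((r + m : ℕ) : ZMod n) = 0 := by
        push_cast
        linear_combination -hmem
      have := Nat.le_of_dvd (by omega) ((ZMod.natCast_eq_zero_iff _ _).1 hmr)
      omega
  refine ⟨⟨s, hs, hcount, fun k hk => (hsc k hk).1⟩, Subtype.ext (funext fun k => ?_)⟩
  exact (hsc k (by omega)).2.symm

theorem Fin.sum_filter_le_natCast {N : ℕ} (g : ℕ → ℕ) (i : Fin N) :
    ∑ j ∈ Finset.univ.filter (· ≤ i), (g j : ℤ) = (∑ j ∈ Finset.range (i + 1), g j : ℕ) := by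
  push_cast
  refine Finset.sum_bij (fun j _ => (j : ℕ)) ?_ ?_ ?_ ?_
  · intro j hj
    simpa [Nat.lt_succ_iff] using hj
  · intro j _ k _ h
    exact Fin.ext h
  · intro j hj
    have := Finset.mem_range.1 hj
    exact ⟨⟨j, by omega⟩, Finset.mem_filter.2 ⟨Finset.mem_univ _, Nat.lt_succ_iff.1 this⟩, rfl⟩
  · intros
    rfl

theorem isStableComposition_iff {n r : ℕ} (g : ℕ → ℕ) :
    (∑ j : Fin (n - r - 1), g j = r ∧
      ∀ i : Fin (n - r - 1),
        ((i : ℤ) + 1) + 1 + 2 * r - n ≤ ∑ j ∈ Finset.univ.filter (· ≤ i), (g j : ℤ) ∧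
        (∑ j ∈ Finset.univ.filter (· ≤ i), (g j : ℤ)) ≤ (i : ℤ) + 1) ↔
    ∑ j ∈ Finset.range (n - r - 1), g j = r ∧
      ∀ i < n - r - 1, i + 2 + 2 * r ≤ ∑ j ∈ Finset.range (i + 1), g j + n ∧
        ∑ j ∈ Finset.range (i + 1), g j ≤ i + 1 := by
  rw [Fin.sum_univ_eq_sum_range g]
  simp only [Fin.sum_filter_le_natCast]
  refine and_congr_right fun _ => ⟨fun h i hi => ?_, fun h i => ?_⟩
  · have := h ⟨i, hi⟩
    dsimp only at this
    omega
  · have := h i i.2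
    omega

/-- The time of the `(i + 1)`-st move of the right `1`. -/
noncomputable def StableWord.moveTime {n r : ℕ} (s : StableWord n r) (i : ℕ) : ℕ :=
  Nat.nth (fun x => x ∈ s.1) i

namespace StableWord

variable {n r : ℕ} (s : StableWord n r)

theorem card_eq : s.1.card = n - r := by
  refine Eq.trans ?_ s.2.2.1
  rw [Nat.count_eq_card_filter_range, Finset.filter_mem_eq_inter, Finset.inter_eq_right.2 s.2.1]

theorem lt_card_of_lt {i : ℕ} (hi : i < n - r) (hf : (Set.ofPred (· ∈ s.1)).Finite) :
    i < hf.toFinset.card := by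
  rwa [show hf.toFinset = s.1 by ext; simp, s.card_eq]

theorem moveTime_mem {i : ℕ} (hi : i < n - r) : s.moveTime i ∈ s.1 :=
  Nat.nth_mem i (s.lt_card_of_lt hi)

theorem moveTime_lt {i : ℕ} (hi : i < n - r) : s.moveTime i < n :=
  Finset.mem_range.1 (s.2.1 (s.moveTime_mem hi))

theorem count_moveTime {i : ℕ} (hi : i < n - r) : Nat.count (· ∈ s.1) (s.moveTime i) = i :=
  Nat.count_nth (s.lt_card_of_lt hi)

theorem count_moveTime_add_one {i : ℕ} (hi : i < n - r) :
    Nat.count (· ∈ s.1) (s.moveTime i + 1) = i + 1 :=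
  Nat.count_nth_succ (s.lt_card_of_lt hi)

theorem moveTime_lt_succ {i : ℕ} (hi : i + 1 < n - r) : s.moveTime i < s.moveTime (i + 1) :=
  Nat.nth_lt_nth' i.lt_succ_self (s.lt_card_of_lt hi)

theorem mem_iff_exists_moveTime {x : ℕ} : x ∈ s.1 ↔ ∃ i < n - r, s.moveTime i = x := by
  constructor
  · intro hx
    refine ⟨Nat.count (· ∈ s.1) x, ?_, Nat.nth_count hx⟩
    exact (Nat.count_strict_mono hx (Finset.mem_range.1 (s.2.1 hx))).trans_eq s.2.2.1
  · rintro ⟨i, hi, rfl⟩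
    exact s.moveTime_mem hi

theorem moveTime_le {i : ℕ} (hi : i < n - r) : s.moveTime i ≤ 2 * i := by
  have h := (s.2.2.2 _ (s.moveTime_lt hi).le).1
  rwa [s.count_moveTime hi] at h

theorem le_moveTime {i : ℕ} (hi : i < n - r) :
    2 * (i + 1) + 2 * r ≤ s.moveTime i + 1 + n := by
  have h := (s.2.2.2 _ (s.moveTime_lt hi)).2
  rwa [Nat.succ_eq_add_one, s.count_moveTime_add_one hi] at h

/-- The number of moves of the left `1` between consecutive moves of the right `1`. -/
noncomputable def gap (i : ℕ) : ℕ :=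
  s.moveTime (i + 1) - s.moveTime i - 1

theorem sum_gap {i : ℕ} (hi : i < n - r) :
    ∑ j ∈ Finset.range i, s.gap j + i = s.moveTime i := by
  induction i with
  | zero =>
    have := s.moveTime_le hi
    simp only [Finset.range_zero, Finset.sum_empty]
    omega
  | succ i ih =>
    have h1 := ih (by omega)
    have h2 := s.moveTime_lt_succ hi
    rw [Finset.sum_range_succ, gap]
    omega

/-- The composition of `r` formed by the gaps of a word. -/
noncomputable def toComposition (hrn : r < n) : StableComposition n r :=
  ⟨fun j => s.gap j, (isStableComposition_iff s.gap).2 <| by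
    constructor
    · have h1 := s.sum_gap (i := n - r - 1) (by omega)
      have h2 := s.moveTime_lt (i := n - r - 1) (by omega)
      have h3 := s.le_moveTime (i := n - r - 1) (by omega)
      omega
    · intro i hi
      have h1 := s.sum_gap (i := i + 1) (by omega)
      have h2 := s.moveTime_le (i := i + 1) (by omega)
      have h3 := s.le_moveTime (i := i + 1) (by omega)
      omega⟩

theorem toComposition_injective (hrn : r < n) :
    Function.Injective fun s : StableWord n r => s.toComposition hrn := by
  intro s t hst
  have hgap (j : ℕ) (hj : j < n - r - 1) : s.gap j = t.gap j :=
    congrFun (congrArg Subtype.val hst) ⟨j, hj⟩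
  have htime (i : ℕ) (hi : i < n - r) : s.moveTime i = t.moveTime i := by
    rw [← s.sum_gap hi, ← t.sum_gap hi]
    congr 1
    exact Finset.sum_congr rfl fun j hj => hgap j (by have := Finset.mem_range.1 hj; omega)
  refine Subtype.ext (Finset.ext fun x => ?_)
  rw [s.mem_iff_exists_moveTime, t.mem_iff_exists_moveTime]
  refine exists_congr fun i => and_congr_right fun hi => ?_
  rw [htime i hi]

theorem toComposition_surjective (hrn : 2 * r + 1 ≤ n) :
    Function.Surjective fun s : StableWord n r => s.toComposition (by omega) := by
  rintro ⟨l, hl⟩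
  obtain ⟨g, rfl⟩ : ∃ g : ℕ → ℕ, l = fun j : Fin (n - r - 1) => g j :=
    ⟨fun j => if h : j < n - r - 1 then l ⟨j, h⟩ else 0, by ext j; simp⟩
  obtain ⟨hsum, hpart⟩ := (isStableComposition_iff g).1 hl
  set T : ℕ → ℕ := fun i => ∑ j ∈ Finset.range i, g j + i with hT
  have hT_succ (i : ℕ) : T (i + 1) = T i + g i + 1 := by
    simp only [hT, Finset.sum_range_succ]
    omega
  have hT_mono : StrictMono T := strictMono_nat_of_lt_succ fun i => by
    have := hT_succ i
    omega
  have hT_le (i : ℕ) (hi : i < n - r) : T i ≤ 2 * i ∧ 2 * (i + 1) + 2 * r ≤ T i + 1 + n := by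
    rcases i with _ | i
    · simp only [hT, Finset.range_zero, Finset.sum_empty]
      omega
    · have := hpart i (by omega)
      simp only [hT]
      omega
  have hT_last : T (n - r - 1) = n - 1 := by
    simp only [hT, hsum]
    omega
  set s : Finset ℕ := (Finset.range (n - r)).image T with hs
  have hcount (k i : ℕ) (hi : i ≤ n - r) (hlt : ∀ j < i, T j < k)
      (hge : ∀ j < n - r, i ≤ j → k ≤ T j) : Nat.count (· ∈ s) k = i := by
    rw [Nat.count_eq_card_filter_range]
    have : (Finset.range k).filter (· ∈ s) = (Finset.range i).image T := by
      ext x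
      simp only [hs, Finset.mem_filter, Finset.mem_range, Finset.mem_image]
      constructor
      · rintro ⟨hx, j, hj, rfl⟩
        refine ⟨j, ?_, rfl⟩
        by_contra! hij
        have := hge j hj hij
        omega
      · rintro ⟨j, hj, rfl⟩
        exact ⟨hlt j hj, j, by omega, rfl⟩
    rw [this, Finset.card_image_of_injective _ hT_mono.injective, Finset.card_range]
  have hT_lt (j : ℕ) (hj : j < n - r) : T j < n := by
    have := hT_mono.monotone (show j ≤ n - r - 1 by omega)
    omega
  have hbal (k : ℕ) (hk : k ≤ n) : IsBalanced n r (Nat.count (· ∈ s) k) k := by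
    obtain ⟨i, hi, hlt, hge⟩ : ∃ i ≤ n - r, (∀ j < i, T j < k) ∧
        ∀ j < n - r, i ≤ j → k ≤ T j := by
      have hex : ∃ i, n - r ≤ i ∨ k ≤ T i := ⟨n - r, .inl le_rfl⟩
      classical
      refine ⟨Nat.find hex, Nat.find_min' hex (.inl le_rfl), fun j hj => ?_, fun j hj hij => ?_⟩
      · have := Nat.find_min hex hj
        omega
      · have := hT_mono.monotone hij
        have := Nat.find_spec hex
        omega
    rw [hcount k i hi hlt hge]
    constructor
    · by_cases h : i < n - r
      · have := hge i h le_rfl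
        have := hT_le i h
        omega
      · omega
    · rcases i with _ | i
      · omega
      · have := hlt i (by omega)
        have := hT_le i (by omega)
        omega
  have hsub : s ⊆ Finset.range n := by
    intro x hx
    obtain ⟨j, hj, rfl⟩ := Finset.mem_image.1 hx
    exact Finset.mem_range.2 (hT_lt j (Finset.mem_range.1 hj))
  let w : StableWord n r := ⟨s, hsub, hcount n (n - r) le_rfl hT_lt (by omega), hbal⟩
  have htime (i : ℕ) (hi : i < n - r) : w.moveTime i = T i := by
    have hmem : T i ∈ s := Finset.mem_image_of_mem T (Finset.mem_range.2 hi)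
    have hc : Nat.count (· ∈ s) (T i) = i :=
      hcount (T i) i hi.le (fun j hj => hT_mono hj) fun j _ hij => hT_mono.monotone hij
    have := Nat.nth_count (p := (· ∈ s)) hmem
    rwa [hc] at this
  refine ⟨w, Subtype.ext (funext fun j => ?_)⟩
  have hj := j.2
  change w.gap j = g j
  rw [gap, htime _ (by omega), htime _ (by omega), hT_succ]
  omega

end StableWord

/-- The minimal circuits in `G_{n,2}` using only `r`-stable vertices and containing
the vertex `ε_{{ℓ,ℓ+r}}` are in bijection with the compositions of `r` into
`n - r - 1` nonnegative parts whose partial sums satisfy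
`i + 1 + 2r - n ≤ λ₁ + ⋯ + λᵢ ≤ i`. -/
theorem stableCircuit_equiv_composition (n r : ℕ) (hn : 3 ≤ n)
    (hr1 : 1 ≤ r) (hr2 : r < n / 2) (ℓ : ℕ) (hℓ : ℓ ∈ Finset.Icc 1 n) :
    Nonempty (StableCircuit n r (ℓ : ZMod n) ≃ StableComposition n r) := by
  have hrn : 2 * r + 1 ≤ n := by omega
  let e₁ := Equiv.ofBijective _
    ⟨StableWord.toCircuit_injective (ℓ : ZMod n) (by omega) hr1 (by omega),
      StableWord.toCircuit_surjective (ℓ : ZMod n) (by omega) hr1 (by omega)⟩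
  let e₂ := Equiv.ofBijective _
    ⟨StableWord.toComposition_injective (n := n) (r := r) (by omega),
      StableWord.toComposition_surjective hrn⟩
  exact ⟨e₁.symm.trans e₂⟩
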